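/- For every real third-order tensor A ∈ ℝ^{n1×n2×n3} there exist tensors U ∈ ℝ^{n1×n1×n3} and V ∈ ℝ^{n2×n2×n3} that are orthogonal with respect to the t-product, and an f-diagonal tensor S ∈ ℝ^{n1×n2×n3}, such that A = U * S * V^H (the tensor singular value decomposition). -/

import Mathlib

/-- The t-product of two third-order real tensors:
`C(i,j,:) = ∑ k, A(i,k,:) ⊛ B(k,j,:)` where `⊛` is circular convolution of tubes. -/
def tprod3 {n1 n2 n4 n3 : ℕ} (A : Fin n1 → Fin n2 → Fin n3 → ℝ)
    (B : Fin n2 → Fin n4 → Fin n3 → ℝ) : Fin n1 → Fin n4 → Fin n3 → ℝ :=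
  fun i j m => ∑ k : Fin n2, ∑ l : Fin n3, A i k l * B k j (m - l)

/-- The tensor (conjugate) transpose: transpose each frontal slice and reverse the
order of the transposed frontal slices 2 through n3, i.e. slice `k ↦ slice (-k)`. -/
def conjT {n1 n2 n3 : ℕ} (A : Fin n1 → Fin n2 → Fin n3 → ℝ) :
    Fin n2 → Fin n1 → Fin n3 → ℝ :=
  fun i j k => A j i (-k)

/-- The identity tensor: first frontal slice is the identity matrix, others zero. -/
def idT {n n3 : ℕ} : Fin n → Fin n → Fin n3 → ℝ :=
  fun i j k => if i = j ∧ (k : ℕ) = 0 then 1 else 0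

/-- A tensor is orthogonal if `Q^H * Q = Q * Q^H = I` (with respect to the t-product). -/
def orthT {n n3 : ℕ} (Q : Fin n → Fin n → Fin n3 → ℝ) : Prop :=
  tprod3 (conjT Q) Q = idT ∧ tprod3 Q (conjT Q) = idT

/-- A tensor is f-diagonal if every frontal slice is a diagonal matrix. -/
def fDiagonal {n1 n2 n3 : ℕ} (S : Fin n1 → Fin n2 → Fin n3 → ℝ) : Prop :=
  ∀ (k : Fin n3) (i : Fin n1) (j : Fin n2), (i : ℕ) ≠ (j : ℕ) → S i j k = 0

open scoped Matrix

namespace Matrix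

/-- The matrix whose columns are the vectors of an orthonormal basis is unitary. -/
theorem _root_.OrthonormalBasis.of_mem_unitaryGroup {𝕜 : Type*} [RCLike 𝕜] {ι : Type*} [Fintype ι]
    [DecidableEq ι] (b : OrthonormalBasis ι 𝕜 (EuclideanSpace 𝕜 ι)) :
    (Matrix.of fun i j => b j i) ∈ Matrix.unitaryGroup ι 𝕜 :=
  (EuclideanSpace.basisFun ι 𝕜).toMatrix_orthonormalBasis_mem_unitary b

theorem exists_unitary_conjTranspose_mul_diagonal {𝕜 : Type*} [RCLike 𝕜] {m n : Type*} [Fintype m]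
    [Fintype n] [DecidableEq n] (M : Matrix m n 𝕜) :
    ∃ V ∈ unitaryGroup n 𝕜, ∃ d : n → 𝕜, (M * V)ᴴ * (M * V) = diagonal d := by
  have hM := isHermitian_conjTranspose_mul_self M
  refine ⟨hM.eigenvectorUnitary, hM.eigenvectorUnitary.2, RCLike.ofReal ∘ hM.eigenvalues, ?_⟩
  rw [← hM.conjStarAlgAut_star_eigenvectorUnitary, Unitary.conjStarAlgAut_star_apply,
    conjTranspose_mul, star_eq_conjTranspose]
  simp only [Matrix.mul_assoc]

theorem exists_svd_of_le {𝕜 : Type*} [RCLike 𝕜] {m n : ℕ} (hnm : n ≤ m)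
    (M : Matrix (Fin m) (Fin n) 𝕜) :
    ∃ U ∈ unitaryGroup (Fin m) 𝕜, ∃ V ∈ unitaryGroup (Fin n) 𝕜,
      ∃ S : Matrix (Fin m) (Fin n) 𝕜,
        (∀ (i : Fin m) (j : Fin n), (i : ℕ) ≠ (j : ℕ) → S i j = 0) ∧ M = U * S * Vᴴ := by
  obtain ⟨V, hV, d, hd⟩ := exists_unitary_conjTranspose_mul_diagonal M
  let c : Fin n → EuclideanSpace 𝕜 (Fin m) := fun j => WithLp.toLp 2 fun i => (M * V) i j
  have hc : ∀ i j, i ≠ j → inner 𝕜 (c i) (c j) = 0 := by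
    intro i j hij
    have h := congrFun (congrFun hd i) j
    rw [diagonal_apply_ne _ hij, mul_apply] at h
    rw [← h, PiLp.inner_apply]
    refine Finset.sum_congr rfl fun k _ => ?_
    simp [c, mul_comm]
  let v : Fin m → EuclideanSpace 𝕜 (Fin m) := fun i =>
    if h : (i : ℕ) < n then ((‖c ⟨i, h⟩‖ : 𝕜)⁻¹) • c ⟨i, h⟩ else 0
  let s : Set (Fin m) := {i | ∃ h : (i : ℕ) < n, c ⟨i, h⟩ ≠ 0}
  have hv : Orthonormal 𝕜 (s.domRestrict v) := by
    constructor
    · rintro ⟨i, h, hi⟩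
      simp only [Set.domRestrict_apply, v, dif_pos h]
      exact norm_smul_inv_norm hi
    · rintro ⟨i, h, hi⟩ ⟨j, h', hj⟩ hij
      simp only [Set.domRestrict_apply, v, dif_pos h, dif_pos h']
      rw [inner_smul_left, inner_smul_right, hc, mul_zero, mul_zero]
      intro e
      apply hij
      simpa [Fin.ext_iff] using e
  obtain ⟨b, hb⟩ := hv.exists_orthonormalBasis_extension_of_card_eq (by simp)
  refine ⟨_, b.of_mem_unitaryGroup, V, hV,
    of fun i j => if (i : ℕ) = (j : ℕ) then (‖c j‖ : 𝕜) else 0, ?_, ?_⟩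
  · intro i j hij
    simp [hij]
  · have key : M * V = of (fun i j => b j i) *
        of fun (i : Fin m) (j : Fin n) => if (i : ℕ) = (j : ℕ) then (‖c j‖ : 𝕜) else 0 := by
      ext i j
      change c j i = _
      rw [mul_apply, Finset.sum_eq_single (Fin.castLE hnm j)]
      · by_cases h0 : c j = 0
        · simp [h0]
        · rw [of_apply, hb (Fin.castLE hnm j) ⟨j.2, h0⟩]
          have : (‖c j‖ : 𝕜) ≠ 0 := by simpa using h0
          simp [v]
          field_simp
      · intro k _ hk
        have : (k : ℕ) ≠ j := fun e => hk (Fin.ext e)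
        simp [this]
      · simp
    rw [← key, Matrix.mul_assoc, ← star_eq_conjTranspose, mem_unitaryGroup_iff.1 hV, Matrix.mul_one]

/-- Singular value decomposition of a rectangular matrix over `ℝ` or `ℂ`. -/
theorem exists_svd {𝕜 : Type*} [RCLike 𝕜] {m n : ℕ} (M : Matrix (Fin m) (Fin n) 𝕜) :
    ∃ U ∈ unitaryGroup (Fin m) 𝕜, ∃ V ∈ unitaryGroup (Fin n) 𝕜,
      ∃ S : Matrix (Fin m) (Fin n) 𝕜,
        (∀ (i : Fin m) (j : Fin n), (i : ℕ) ≠ (j : ℕ) → S i j = 0) ∧ M = U * S * Vᴴ := by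
  rcases le_total n m with h | h
  · exact exists_svd_of_le h M
  · obtain ⟨U, hU, V, hV, S, hS, e⟩ := exists_svd_of_le h Mᴴ
    refine ⟨V, hV, U, hU, Sᴴ, fun i j hij => ?_, ?_⟩
    · rw [conjTranspose_apply, hS j i hij.symm, star_zero]
    · rw [← conjTranspose_conjTranspose M, e]
      simp [Matrix.mul_assoc]

/-- `U`, `S`, `V` form a singular value decomposition of the complex matrix `M`. -/
structure IsSVD {m n : ℕ} (M : Matrix (Fin m) (Fin n) ℂ) (U : Matrix (Fin m) (Fin m) ℂ)
    (S : Matrix (Fin m) (Fin n) ℂ) (V : Matrix (Fin n) (Fin n) ℂ) : Prop where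
  left_mem : U ∈ unitaryGroup (Fin m) ℂ
  right_mem : V ∈ unitaryGroup (Fin n) ℂ
  diag : ∀ (i : Fin m) (j : Fin n), (i : ℕ) ≠ (j : ℕ) → S i j = 0
  eq : M = U * S * Vᴴ

theorem map_mem_unitaryGroup {𝕜 𝕜' n : Type*} [CommRing 𝕜] [StarRing 𝕜] [CommRing 𝕜']
    [StarRing 𝕜'] [Fintype n] [DecidableEq n] (f : 𝕜 →+* 𝕜') (hf : ∀ x, f (star x) = star (f x))
    {U : Matrix n n 𝕜} (hU : U ∈ unitaryGroup n 𝕜) : U.map f ∈ unitaryGroup n 𝕜' := by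
  rw [mem_unitaryGroup_iff, star_eq_conjTranspose] at hU ⊢
  rw [← conjTranspose_map f hf, ← Matrix.map_mul, hU]
  exact Matrix.map_one f (map_zero f) (map_one f)

theorem IsSVD.map_star {m n : ℕ} {M : Matrix (Fin m) (Fin n) ℂ} {U : Matrix (Fin m) (Fin m) ℂ}
    {S : Matrix (Fin m) (Fin n) ℂ} {V : Matrix (Fin n) (Fin n) ℂ} (h : IsSVD M U S V) :
    IsSVD (M.map (starRingEnd ℂ)) (U.map (starRingEnd ℂ)) (S.map (starRingEnd ℂ))
      (V.map (starRingEnd ℂ)) where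
  left_mem := map_mem_unitaryGroup _ (fun _ => rfl) h.left_mem
  right_mem := map_mem_unitaryGroup _ (fun _ => rfl) h.right_mem
  diag i j hij := by simp [h.diag i j hij]
  eq := by
    conv_lhs => rw [h.eq]
    rw [Matrix.map_mul, Matrix.map_mul, conjTranspose_map (starRingEnd ℂ) (fun _ => rfl)]

theorem exists_isSVD {m n : ℕ} (M : Matrix (Fin m) (Fin n) ℂ) : ∃ U S V, IsSVD M U S V := by
  obtain ⟨U, hU, V, hV, S, hS, e⟩ := exists_svd M
  exact ⟨U, S, V, hU, hV, hS, e⟩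

theorem map_starRingEnd_map_ofReal {m n : Type*} (M : Matrix m n ℝ) :
    (M.map Complex.ofRealHom).map (starRingEnd ℂ) = M.map Complex.ofRealHom := by
  ext i j
  simp

/-- A complex matrix with real entries has a singular value decomposition with real factors. -/
theorem exists_isSVD_of_map_star_eq {m n : ℕ} (M : Matrix (Fin m) (Fin n) ℂ)
    (hM : M.map (starRingEnd ℂ) = M) :
    ∃ U S V, IsSVD M U S V ∧ U.map (starRingEnd ℂ) = U ∧ S.map (starRingEnd ℂ) = S ∧
      V.map (starRingEnd ℂ) = V := by
  have hre : M = (M.map Complex.re).map Complex.ofRealHom := by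
    ext i j
    exact (Complex.conj_eq_iff_re.1 (congrFun (congrFun hM i) j)).symm
  obtain ⟨U, hU, V, hV, S, hS, e⟩ := exists_svd (M.map Complex.re)
  refine ⟨U.map Complex.ofRealHom, S.map Complex.ofRealHom, V.map Complex.ofRealHom,
    ⟨?_, ?_, ?_, ?_⟩, ?_, ?_, ?_⟩
  · exact map_mem_unitaryGroup _ (by simp) hU
  · exact map_mem_unitaryGroup _ (by simp) hV
  · intro i j hij
    simp [hS i j hij]
  · rw [hre, e, Matrix.map_mul, Matrix.map_mul, conjTranspose_map Complex.ofRealHom fun x => by simp]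
  all_goals exact map_starRingEnd_map_ofReal _

/-- A conjugate-symmetric family of complex matrices has a conjugate-symmetric family of singular
value decompositions. -/
theorem exists_isSVD_family {N m n : ℕ} [NeZero N] (M : ZMod N → Matrix (Fin m) (Fin n) ℂ)
    (hM : ∀ k, M (-k) = (M k).map (starRingEnd ℂ)) :
    ∃ (U : ZMod N → Matrix (Fin m) (Fin m) ℂ) (S : ZMod N → Matrix (Fin m) (Fin n) ℂ)
      (V : ZMod N → Matrix (Fin n) (Fin n) ℂ), (∀ k, IsSVD (M k) (U k) (S k) (V k)) ∧
      (∀ k, U (-k) = (U k).map (starRingEnd ℂ)) ∧ (∀ k, S (-k) = (S k).map (starRingEnd ℂ)) ∧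
      ∀ k, V (-k) = (V k).map (starRingEnd ℂ) := by
  have hex : ∀ k, ∃ U S V, IsSVD (M k) U S V ∧ (-k = k → U.map (starRingEnd ℂ) = U ∧
      S.map (starRingEnd ℂ) = S ∧ V.map (starRingEnd ℂ) = V) := by
    intro k
    by_cases hk : -k = k
    · obtain ⟨U, S, V, h, h'⟩ := exists_isSVD_of_map_star_eq (M k) (by rw [← hM, hk])
      exact ⟨U, S, V, h, fun _ => h'⟩
    · obtain ⟨U, S, V, h⟩ := exists_isSVD (M k)
      exact ⟨U, S, V, h, fun h' => absurd h' hk⟩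
  choose U S V h hself using hex
  have hsymm : ∀ {p q : ℕ} (F : ZMod N → Matrix (Fin p) (Fin q) ℂ),
      (∀ k, -k = k → (F k).map (starRingEnd ℂ) = F k) → ∀ k : ZMod N,
      (if (-k).val ≤ (- -k).val then F (-k) else (F (- -k)).map (starRingEnd ℂ)) =
      (if k.val ≤ (-k).val then F k else (F (-k)).map (starRingEnd ℂ)).map (starRingEnd ℂ) := by
    intro p q F hF k
    have hinv : ∀ X : Matrix (Fin p) (Fin q) ℂ,
        (X.map (starRingEnd ℂ)).map (starRingEnd ℂ) = X := fun X => by ext; simp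
    rw [neg_neg]
    rcases lt_trichotomy k.val (-k).val with hlt | heq | hgt
    · rw [if_neg hlt.not_ge, if_pos hlt.le]
    · have hk : -k = k := (ZMod.val_injective N heq).symm
      simp [hk, hF k hk]
    · rw [if_pos hgt.le, if_neg hgt.not_ge, hinv]
  refine ⟨fun k => if k.val ≤ (-k).val then U k else (U (-k)).map (starRingEnd ℂ),
    fun k => if k.val ≤ (-k).val then S k else (S (-k)).map (starRingEnd ℂ),
    fun k => if k.val ≤ (-k).val then V k else (V (-k)).map (starRingEnd ℂ), fun k => ?_,
    hsymm U fun k hk => (hself k hk).1, hsymm S fun k hk => (hself k hk).2.1,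
    hsymm V fun k hk => (hself k hk).2.2⟩
  dsimp only
  split_ifs
  · exact h k
  · have := (h (-k)).map_star
    rwa [← hM, neg_neg] at this

end Matrix

open Matrix

/-- The `k`-th frontal slice of the discrete Fourier transform of a tensor along its tubes. -/
noncomputable def dftSlice {n1 n2 n : ℕ} (A : Fin n1 → Fin n2 → Fin (n + 1) → ℝ)
    (k : ZMod (n + 1)) : Matrix (Fin n1) (Fin n2) ℂ :=
  Matrix.of fun i j => ZMod.dft (fun l : ZMod (n + 1) => (A i j l : ℂ)) k

theorem dftSlice_apply {n1 n2 n : ℕ} (A : Fin n1 → Fin n2 → Fin (n + 1) → ℝ)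
    (k : ZMod (n + 1)) (i : Fin n1) (j : Fin n2) :
    dftSlice A k i j = ∑ l : ZMod (n + 1), ZMod.stdAddChar (-(l * k)) * (A i j l : ℂ) :=
  rfl

theorem dftSlice_injective {n1 n2 n : ℕ} {A B : Fin n1 → Fin n2 → Fin (n + 1) → ℝ}
    (h : ∀ k, dftSlice A k = dftSlice B k) : A = B := by
  funext i j l
  have : (fun l : ZMod (n + 1) => (A i j l : ℂ)) = fun l : ZMod (n + 1) => (B i j l : ℂ) :=
    ZMod.dft.injective (funext fun k => congrFun (congrFun (h k) i) j)
  exact_mod_cast congrFun this l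

theorem dftSlice_neg {n1 n2 n : ℕ} (A : Fin n1 → Fin n2 → Fin (n + 1) → ℝ)
    (k : ZMod (n + 1)) : dftSlice A (-k) = (dftSlice A k).map (starRingEnd ℂ) := by
  ext i j
  rw [map_apply, dftSlice_apply, dftSlice_apply, map_sum]
  refine Finset.sum_congr rfl fun l _ => ?_
  rw [map_mul, ← AddChar.map_neg_eq_conj, Complex.conj_ofReal, mul_neg]

theorem dftSlice_conjT {n1 n2 n : ℕ} (A : Fin n1 → Fin n2 → Fin (n + 1) → ℝ)
    (k : ZMod (n + 1)) : dftSlice (conjT A) k = (dftSlice A k)ᴴ := by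
  ext i j
  rw [conjTranspose_apply, dftSlice_apply, dftSlice_apply, star_sum]
  refine Fintype.sum_equiv (Equiv.neg (ZMod (n + 1))) _ _ fun l => ?_
  rw [star_mul', ← starRingEnd_apply, ← starRingEnd_apply, ← AddChar.map_neg_eq_conj,
    Complex.conj_ofReal, Equiv.neg_apply, neg_neg, neg_mul]
  rfl

theorem dftSlice_idT {m n : ℕ} (k : ZMod (n + 1)) :
    dftSlice (idT : Fin m → Fin m → Fin (n + 1) → ℝ) k = 1 := by
  ext i j
  rw [dftSlice_apply, Finset.sum_eq_single 0]
  · by_cases h : i = j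
    · subst h
      have : (idT i i (0 : Fin (n + 1)) : ℝ) = 1 := by simp [idT]
      rw [one_apply_eq, zero_mul, neg_zero, AddChar.map_zero_eq_one, one_mul]
      exact_mod_cast this
    · simp [idT, h]
  · intro l _ hl
    have : ¬ (Fin.val (n := n + 1) l = 0) := fun e => hl (Fin.ext (n := n + 1) e)
    simp only [idT, this, and_false, if_false, Complex.ofReal_zero, mul_zero]
  · simp

theorem dftSlice_tprod3 {n1 n2 n4 n : ℕ} (A : Fin n1 → Fin n2 → Fin (n + 1) → ℝ)
    (B : Fin n2 → Fin n4 → Fin (n + 1) → ℝ) (k : ZMod (n + 1)) :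
    dftSlice (tprod3 A B) k = dftSlice A k * dftSlice B k := by
  have htprod : ∀ i j (m : ZMod (n + 1)),
      tprod3 A B i j m = ∑ p, ∑ l : ZMod (n + 1), A i p l * B p j (m - l : ZMod (n + 1)) :=
    fun _ _ _ => rfl
  ext i j
  rw [mul_apply, dftSlice_apply]
  simp_rw [htprod, Complex.ofReal_sum, Finset.mul_sum]
  rw [Finset.sum_comm]
  refine Finset.sum_congr rfl fun p _ => ?_
  rw [dftSlice_apply, dftSlice_apply, Finset.sum_mul_sum, Finset.sum_comm]
  refine Finset.sum_congr rfl fun l _ => ?_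
  refine Fintype.sum_equiv (Equiv.subRight l) _ _ fun m => ?_
  have : -(m * k) = -(l * k) + -((m - l) * k) := by ring
  rw [this, AddChar.map_add_eq_mul, Complex.ofReal_mul, Equiv.subRight_apply]
  ring

theorem exists_dftSlice_eq {n1 n2 n : ℕ} (F : ZMod (n + 1) → Matrix (Fin n1) (Fin n2) ℂ)
    (hF : ∀ k, F (-k) = (F k).map (starRingEnd ℂ)) :
    ∃ A : Fin n1 → Fin n2 → Fin (n + 1) → ℝ, ∀ k, dftSlice A k = F k := by
  let a : Fin n1 → Fin n2 → ZMod (n + 1) → ℂ := fun i j => ZMod.dft.symm fun k => F k i j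
  have hconj : ∀ i j l, starRingEnd ℂ (a i j l) = a i j l := by
    intro i j l
    simp only [a, ZMod.invDFT_apply, smul_eq_mul, map_mul, map_inv₀, map_natCast, map_sum]
    congr 1
    refine Fintype.sum_equiv (Equiv.neg _) _ _ fun k => ?_
    rw [Equiv.neg_apply, hF, map_apply, ← AddChar.map_neg_eq_conj, neg_mul]
  refine ⟨fun i j l => (a i j l).re, fun k => ?_⟩
  ext i j
  have h : (fun l : ZMod (n + 1) => (((a i j l).re : ℝ) : ℂ)) = a i j :=
    funext fun l => Complex.conj_eq_iff_re.1 (hconj i j l)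
  change ZMod.dft (fun l : ZMod (n + 1) => (((a i j l).re : ℝ) : ℂ)) k = F k i j
  rw [h, LinearEquiv.apply_symm_apply]

theorem orthT_of_dftSlice_mem_unitaryGroup {m n : ℕ} {Q : Fin m → Fin m → Fin (n + 1) → ℝ}
    (h : ∀ k, dftSlice Q k ∈ unitaryGroup (Fin m) ℂ) : orthT Q := by
  constructor <;> refine dftSlice_injective fun k => ?_
  · rw [dftSlice_tprod3, dftSlice_conjT, dftSlice_idT]
    exact mem_unitaryGroup_iff'.1 (h k)
  · rw [dftSlice_tprod3, dftSlice_conjT, dftSlice_idT]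
    exact mem_unitaryGroup_iff.1 (h k)

theorem fDiagonal_of_dftSlice {n1 n2 n : ℕ} {S : Fin n1 → Fin n2 → Fin (n + 1) → ℝ}
    (h : ∀ k (i : Fin n1) (j : Fin n2), (i : ℕ) ≠ (j : ℕ) → dftSlice S k i j = 0) :
    fDiagonal S := by
  intro l i j hij
  have : (fun l : ZMod (n + 1) => (S i j l : ℂ)) = 0 :=
    (LinearEquiv.map_eq_zero_iff ZMod.dft).1 (funext fun k => h k i j hij)
  exact Complex.ofReal_eq_zero.1 (congrFun this l)

/-- t-SVD: every real third-order tensor factors as `A = U * S * V^H` with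
`U`, `V` orthogonal and `S` f-diagonal. -/
theorem tSVD_exists {n1 n2 n3 : ℕ} (A : Fin n1 → Fin n2 → Fin n3 → ℝ) :
    ∃ (U : Fin n1 → Fin n1 → Fin n3 → ℝ) (S : Fin n1 → Fin n2 → Fin n3 → ℝ)
      (V : Fin n2 → Fin n2 → Fin n3 → ℝ),
      orthT U ∧ orthT V ∧ fDiagonal S ∧ A = tprod3 (tprod3 U S) (conjT V) := by
  cases n3 with
  | zero =>
    refine ⟨fun _ _ => Fin.elim0, fun _ _ => Fin.elim0, fun _ _ => Fin.elim0,
      ⟨?_, ?_⟩, ⟨?_, ?_⟩, fun k => k.elim0, ?_⟩ <;>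
    exact funext fun _ => funext fun _ => funext fun k => k.elim0
  | succ n =>
    obtain ⟨U', S', V', h, hU', hS', hV'⟩ := exists_isSVD_family (dftSlice A) (dftSlice_neg A)
    obtain ⟨U, hU⟩ := exists_dftSlice_eq U' hU'
    obtain ⟨S, hS⟩ := exists_dftSlice_eq S' hS'
    obtain ⟨V, hV⟩ := exists_dftSlice_eq V' hV'
    refine ⟨U, S, V, orthT_of_dftSlice_mem_unitaryGroup fun k => ?_,
      orthT_of_dftSlice_mem_unitaryGroup fun k => ?_, fDiagonal_of_dftSlice fun k => ?_,
      dftSlice_injective fun k => ?_⟩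
    · rw [hU]
      exact (h k).left_mem
    · rw [hV]
      exact (h k).right_mem
    · rw [hS]
      exact (h k).diag
    · rw [dftSlice_tprod3, dftSlice_tprod3, dftSlice_conjT, hU, hS, hV]
      exact (h k).eq
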